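/- There exists an absolute constant C > 0 such that for every ε ∈ (0, 1] the following holds. Let R = [0, 1] × [−2ε^{−1/2}, 0] be an axis-parallel rectangle of width 1 and height 2ε^{−1/2}, let p = (0, 0) be the upper-left corner of R, and let q = (1, y_q) with y_q ≥ 0 be a point on the vertical line through the right side of R. Let L be a tame path from p to q that lies on or above the line through p and q. Then there exists a geometric graph E comprised of the edges of L together with additional segments of total weight at most C · ε^{−1/2}, such that for every point s on the bottom side [0,1] × {−2ε^{−1/2}} of R and every t ∈ L, there is an st-path P in E with weight ‖P‖ ≤ (1 + C·ε)·‖s − t‖. -/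

import Mathlib

open scoped Classical

noncomputable section

/-- The Euclidean plane. -/
abbrev Plane : Type := EuclideanSpace ℝ (Fin 2)

/-- The point `(x, y) ∈ ℝ²`. -/
def pt (x y : ℝ) : Plane := (EuclideanSpace.equiv (Fin 2) ℝ).symm ![x, y]

/-- The union of the segments of a geometric graph. -/
def segUnion (E : Finset (Plane × Plane)) : Set Plane :=
  ⋃ e ∈ E, segment ℝ e.1 e.2

/-- The total weight of a geometric graph: the sum of the Euclidean lengths of its
segments. -/
def gweight (E : Finset (Plane × Plane)) : ℝ :=
  ∑ e ∈ E, ‖e.1 - e.2‖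

/-- `HasPath E s t w` : there is a polygonal path from `s` to `t`, each of whose edges is
contained in the union of the segments of `E`, of weight at most `w`. -/
def HasPath (E : Finset (Plane × Plane)) (s t : Plane) (w : ℝ) : Prop :=
  ∃ (m : ℕ) (v : ℕ → Plane), v 0 = s ∧ v m = t ∧
    (∀ i < m, segment ℝ (v i) (v (i + 1)) ⊆ segUnion E) ∧
    ∑ i ∈ Finset.range m, ‖v (i + 1) - v i‖ ≤ w

/-- A rectilinear path: every edge is horizontal or vertical. -/
def IsRectilinear (n : ℕ) (u : ℕ → Plane) : Prop :=
  ∀ i < n, u i 0 = u (i + 1) 0 ∨ u i 1 = u (i + 1) 1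

/-- The set of points of the polygonal path with vertices `u 0, …, u n`. -/
def pathSet (n : ℕ) (u : ℕ → Plane) : Set Plane :=
  ⋃ i ∈ Finset.range n, segment ℝ (u i) (u (i + 1))

/-- The edges of the polygonal path with vertices `u 0, …, u n`, as a geometric graph. -/
def pathEdges (n : ℕ) (u : ℕ → Plane) : Finset (Plane × Plane) :=
  (Finset.range n).image fun i => (u i, u (i + 1))

/-- The region below an `x`-monotone path with point set `L` : points `p` that lie
vertically below some point of `L` and not below the lowest point of `L`. -/
def belowRegion (L : Set Plane) : Set Plane :=
  {p | (∃ q ∈ L, q 0 = p 0 ∧ p 1 ≤ q 1) ∧ (∃ q ∈ L, q 1 ≤ p 1)}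

/-- The length of the subpath of the path `u 0, …, u n` from a point `a` on the `i`-th
edge to a point `b` on the `j`-th edge (for `i ≤ j`). -/
def subLen (u : ℕ → Plane) (i j : ℕ) (a b : Plane) : ℝ :=
  if i = j then ‖b - a‖
  else ‖u (i + 1) - a‖ + (∑ k ∈ Finset.Ico (i + 1) j, ‖u (k + 1) - u k‖) + ‖b - u j‖

/-- The point set of the subpath of the path `u 0, …, u n` from a point `a` on the `i`-th
edge to a point `b` on the `j`-th edge (for `i ≤ j`). -/
def subSet (u : ℕ → Plane) (i j : ℕ) (a b : Plane) : Set Plane :=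
  if i = j then segment ℝ a b
  else segment ℝ a (u (i + 1)) ∪
    (⋃ k ∈ Finset.Ico (i + 1) j, segment ℝ (u k) (u (k + 1))) ∪ segment ℝ (u j) b

/-- A tame path: an `x`-monotone (nondecreasing) rectilinear path such that for every
horizontal chord `ab` (with `a`, `b` on the path and the segment `ab` contained in the
region below the path), the subpath between `a` and `b` has length at most `2·‖a − b‖`. -/
def IsTamePath (n : ℕ) (u : ℕ → Plane) : Prop :=
  IsRectilinear n u ∧ (∀ i < n, u i 0 ≤ u (i + 1) 0) ∧
  ∀ (i j : ℕ) (a b : Plane), i ≤ j → j < n →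
    a ∈ segment ℝ (u i) (u (i + 1)) → b ∈ segment ℝ (u j) (u (j + 1)) →
    a 1 = b 1 → segment ℝ a b ⊆ belowRegion (pathSet n u) →
    subLen u i j a b ≤ 2 * ‖a - b‖

section Helpers

@[simp] lemma pt_zero (x y : ℝ) : pt x y 0 = x := rfl

@[simp] lemma pt_one (x y : ℝ) : pt x y 1 = y := rfl

lemma pt_eta (a : Plane) : pt (a 0) (a 1) = a := by
  ext i; fin_cases i <;> rfl

lemma norm_plane (a : Plane) : ‖a‖ = √(a 0 ^ 2 + a 1 ^ 2) := by
  simp [EuclideanSpace.norm_eq, Fin.sum_univ_two]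

lemma snd_sub_le_norm (a b : Plane) : b 1 - a 1 ≤ ‖b - a‖ := by
  rw [norm_plane]
  exact Real.le_sqrt_of_sq_le (by simp; nlinarith [sq_nonneg (b 0 - a 0)])

lemma norm_sub_of_fst_eq {a b : Plane} (h : a 0 = b 0) : ‖b - a‖ = |b 1 - a 1| := by
  rw [norm_plane]
  simp [h, Real.sqrt_sq_eq_abs]

lemma norm_sub_of_snd_eq {a b : Plane} (h : a 1 = b 1) : ‖b - a‖ = |b 0 - a 0| := by
  rw [norm_plane]
  simp [h, Real.sqrt_sq_eq_abs]

lemma apply_mem_segment {a b t : Plane} (ht : t ∈ segment ℝ a b) :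
    ∃ r : ℝ, 0 ≤ r ∧ r ≤ 1 ∧ t = a + r • (b - a) := by
  rw [segment_eq_image'] at ht
  obtain ⟨r, hr, rfl⟩ := ht
  exact ⟨r, hr.1, hr.2, rfl⟩

lemma mem_segment_vertical {x y z v : ℝ} (h₁ : y ≤ v) (h₂ : v ≤ z) :
    pt x v ∈ segment ℝ (pt x y) (pt x z) := by
  rcases eq_or_lt_of_le (h₁.trans h₂) with h | h
  · have : v = y := by linarith
    subst this
    exact left_mem_segment _ _ _
  · rw [segment_eq_image']
    have hz : z - y ≠ 0 := by linarith
    refine ⟨(v - y) / (z - y),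
      ⟨div_nonneg (by linarith) (by linarith), (div_le_one (by linarith)).2 (by linarith)⟩, ?_⟩
    ext i
    fin_cases i
    · simp [pt]
    · simp [pt]
      field_simp
      ring

lemma segment_subset_of_mem {a b c d : Plane} (h₁ : a ∈ segment ℝ c d)
    (h₂ : b ∈ segment ℝ c d) : segment ℝ a b ⊆ segment ℝ c d :=
  (convex_segment c d).segment_subset h₁ h₂

/-- There is a polygonal path from `s` to `t` inside `B` of weight at most `w`. -/
def Reach (B : Set Plane) (s t : Plane) (w : ℝ) : Prop :=
  ∃ (m : ℕ) (v : ℕ → Plane), v 0 = s ∧ v m = t ∧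
    (∀ i < m, segment ℝ (v i) (v (i + 1)) ⊆ B) ∧
    ∑ i ∈ Finset.range m, ‖v (i + 1) - v i‖ ≤ w

namespace Reach

lemma mono {B B' : Set Plane} {s t : Plane} {w w' : ℝ} (h : Reach B s t w) (hB : B ⊆ B')
    (hw : w ≤ w') : Reach B' s t w' := by
  obtain ⟨m, v, h0, hm, hs, hl⟩ := h
  exact ⟨m, v, h0, hm, fun i hi => (hs i hi).trans hB, hl.trans hw⟩

lemma refl (B : Set Plane) (s : Plane) : Reach B s s 0 :=
  ⟨0, fun _ => s, rfl, rfl, by simp, by simp⟩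

/-- Prepend one edge to a path. -/
lemma cons {B : Set Plane} {s t r : Plane} {w : ℝ} (hst : segment ℝ s t ⊆ B)
    (h : Reach B t r w) : Reach B s r (‖t - s‖ + w) := by
  obtain ⟨m, v, h0, hm, hs, hl⟩ := h
  refine ⟨m + 1, fun i => Nat.casesOn i s v, rfl, hm, ?_, ?_⟩
  · rintro (_ | i) hi
    · simpa [h0] using hst
    · exact hs i (by omega)
  · rw [Finset.sum_range_succ']
    simp only [h0]
    change _ + ‖t - s‖ ≤ _
    linarith

lemma single {B : Set Plane} {s t : Plane} (hst : segment ℝ s t ⊆ B) :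
    Reach B s t ‖t - s‖ := by
  simpa using cons hst (refl B t)

lemma trans {B : Set Plane} {s t r : Plane} {w w' : ℝ} (h : Reach B s t w)
    (h' : Reach B t r w') : Reach B s r (w + w') := by
  obtain ⟨m, v, h0, hm, hs, hl⟩ := h
  induction m generalizing v s w with
  | zero =>
    have : s = t := h0.symm.trans hm
    subst this
    exact h'.mono subset_rfl (by simpa using hl)
  | succ m ih =>
    rw [Finset.sum_range_succ'] at hl
    have := ih (s := v 1) (w := w - ‖v 1 - v 0‖) (fun i => v (i + 1)) rfl hm
      (fun i hi => hs (i + 1) (by omega)) (by linarith)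
    subst h0
    exact (cons (hs 0 (by omega)) this).mono subset_rfl (by linarith)

lemma symm {B : Set Plane} {s t : Plane} {w : ℝ} (h : Reach B s t w) : Reach B t s w := by
  obtain ⟨m, v, h0, hm, hs, hl⟩ := h
  refine ⟨m, fun i => v (m - i), by simpa using hm, by simpa using h0, ?_, ?_⟩
  · intro i hi
    have h1 : m - i = m - (i + 1) + 1 := by omega
    change segment ℝ (v (m - i)) (v (m - (i + 1))) ⊆ B
    rw [h1, segment_symm]
    exact hs _ (by omega)
  · refine le_trans (le_of_eq ?_) hl
    rw [← Finset.sum_range_reflect]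
    refine Finset.sum_congr rfl fun i hi => ?_
    have hi' := Finset.mem_range.1 hi
    have h1 : m - (m - 1 - i + 1) = i := by omega
    have h2 : m - (m - 1 - i) = i + 1 := by omega
    simp only [h1, h2]
    exact norm_sub_rev _ _

lemma image {B : Set Plane} {s t : Plane} {w : ℝ} (h : Reach B s t w)
    (φ : Plane →ᵃⁱ[ℝ] Plane) : Reach (φ '' B) (φ s) (φ t) w := by
  obtain ⟨m, v, h0, hm, hs, hl⟩ := h
  refine ⟨m, fun i => φ (v i), by simp only [h0], by simp only [hm], ?_, ?_⟩
  · intro i hi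
    have := image_segment ℝ φ.toAffineMap (v i) (v (i + 1))
    rw [show segment ℝ (φ (v i)) (φ (v (i + 1))) = φ '' segment ℝ (v i) (v (i + 1)) from
      this.symm]
    exact Set.image_mono (hs i hi)
  · refine le_trans (le_of_eq (Finset.sum_congr rfl fun i _ => ?_)) hl
    rw [← dist_eq_norm, ← dist_eq_norm, φ.dist_map]

lemma vertical {B : Set Plane} {x y z y' z' : ℝ}
    (hB : segment ℝ (pt x y') (pt x z') ⊆ B) (h₁ : y' ≤ y) (h : y ≤ z) (h₂ : z ≤ z') :
    Reach B (pt x y) (pt x z) (z - y) := by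
  have := single (B := B) (s := pt x y) (t := pt x z)
    ((segment_subset_of_mem (mem_segment_vertical h₁ (h.trans h₂))
      (mem_segment_vertical (h₁.trans h) h₂)).trans hB)
  rwa [norm_sub_of_fst_eq (by simp), pt_one, pt_one, abs_of_nonneg (by linarith)] at this

end Reach

lemma segUnion_union (E F : Finset (Plane × Plane)) :
    segUnion (E ∪ F) = segUnion E ∪ segUnion F := by
  ext z; simp only [segUnion, Finset.mem_union, Set.mem_iUnion, Set.mem_union, exists_prop]
  grind

lemma segment_subset_segUnion {E : Finset (Plane × Plane)} {a b : Plane} (h : (a, b) ∈ E) :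
    segment ℝ a b ⊆ segUnion E := fun _ hz => Set.mem_iUnion₂.2 ⟨(a, b), h, hz⟩

lemma gweight_union_le (E F : Finset (Plane × Plane)) :
    gweight (E ∪ F) ≤ gweight E + gweight F := by
  unfold gweight
  rw [← Finset.sum_union_inter]
  exact le_add_of_nonneg_right (Finset.sum_nonneg fun _ _ => norm_nonneg _)

lemma gweight_singleton (a b : Plane) : gweight {(a, b)} = ‖b - a‖ := by
  simp [gweight, norm_sub_rev]

/-- The excess of the length of an edge over its signed height. -/
def ecost (a b : Plane) : ℝ := ‖b - a‖ - (b 1 - a 1)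

lemma ecost_nonneg (a b : Plane) : 0 ≤ ecost a b :=
  sub_nonneg.2 (snd_sub_le_norm a b)

lemma ecost_of_mem {a b : Plane} {r : ℝ} (hr : 0 ≤ r) :
    ecost a (a + r • (b - a)) = r * ecost a b := by
  simp [ecost, norm_smul, abs_of_nonneg hr]; ring

lemma ecost_to_end {a b : Plane} {r : ℝ} (hr : r ≤ 1) :
    ecost (a + r • (b - a)) b = (1 - r) * ecost a b := by
  have : b - (a + r • (b - a)) = (1 - r) • (b - a) := by module
  simp [ecost, this, norm_smul, abs_of_nonneg (sub_nonneg.2 hr)]; ring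

/-- A horizontal or vertical edge with nondecreasing `x`-coordinate. -/
def StairEdge (a b : Plane) : Prop := a 0 ≤ b 0 ∧ (a 0 = b 0 ∨ a 1 = b 1)

lemma StairEdge.fst_sub_le {a b : Plane} (h : StairEdge a b) : b 0 - a 0 ≤ ecost a b := by
  rcases h.2 with h' | h'
  · linarith [ecost_nonneg a b]
  · rw [ecost, norm_sub_of_snd_eq h', h']
    linarith [le_abs_self (b 0 - a 0)]

lemma StairEdge.fst_add_snd_sub_le {a b : Plane} (h : StairEdge a b) {S : ℝ} (hS : 0 ≤ S) :
    S * (b 0 - a 0) + (a 1 - b 1) ≤ (S + 1) * ecost a b := by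
  have h0 := ecost_nonneg a b
  rcases h.2 with h' | h'
  · have : a 1 - b 1 ≤ ecost a b := by
      have := norm_nonneg (b - a)
      unfold ecost; linarith
    have := mul_nonneg hS h0
    rw [h']; linarith
  · have := mul_le_mul_of_nonneg_left h.fst_sub_le hS
    rw [h']; linarith

/-- `Stair A a b c X`: there is an `x`-monotone rectilinear path in `A` from `a` to `b` with point
set `X` whose length exceeds the signed height `b 1 - a 1` by exactly `c`. -/
inductive Stair (A : Set Plane) : Plane → Plane → ℝ → Set Plane → Prop
  | nil (a : Plane) : Stair A a a 0 {a}
  | cons {a b d : Plane} {c : ℝ} {X : Set Plane} (hab : StairEdge a b)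
      (hA : segment ℝ a b ⊆ A) (h : Stair A b d c X) :
      Stair A a d (ecost a b + c) (segment ℝ a b ∪ X)

namespace Stair

variable {A : Set Plane}

lemma cost_nonneg {a b : Plane} {c : ℝ} {X : Set Plane} (h : Stair A a b c X) : 0 ≤ c := by
  induction h with
  | nil => rfl
  | cons _ _ _ ih => exact add_nonneg (ecost_nonneg _ _) ih

lemma split {a d : Plane} {c σ : ℝ} {X : Set Plane} (h : Stair A a d c X) (h0 : 0 ≤ σ)
    (hc : σ ≤ c) : ∃ m X₁ X₂, Stair A a m σ X₁ ∧ Stair A m d (c - σ) X₂ ∧ X ⊆ X₁ ∪ X₂ := by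
  induction h generalizing σ with
  | nil a =>
    obtain rfl : σ = 0 := le_antisymm hc h0
    exact ⟨a, {a}, {a}, nil a, by simpa using nil a, by simp⟩
  | @cons a b d c X hab hA h ih =>
    rcases le_or_gt σ (ecost a b) with hσ | hσ
    · obtain ⟨r, hr0, hr1, hr⟩ : ∃ r : ℝ, 0 ≤ r ∧ r ≤ 1 ∧ r * ecost a b = σ := by
        rcases eq_or_lt_of_le (ecost_nonneg a b) with he | he
        · exact ⟨0, le_rfl, zero_le_one, by linarith⟩
        · exact ⟨σ / ecost a b, by positivity, (div_le_one he).2 hσ, by field_simp⟩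
      set m := a + r • (b - a) with hm
      have hmem : m ∈ segment ℝ a b := by
        rw [segment_eq_image']; exact ⟨r, ⟨hr0, hr1⟩, rfl⟩
      have hm0 : m 0 = a 0 + r * (b 0 - a 0) := by simp [hm]
      have hm1 : m 1 = a 1 + r * (b 1 - a 1) := by simp [hm]
      have hx := hab.1
      have ham : StairEdge a m := by
        refine ⟨by rw [hm0]; nlinarith, hab.2.imp (fun h => ?_) fun h => ?_⟩
        · rw [hm0, h]; ring
        · rw [hm1, h]; ring
      have hmb : StairEdge m b := by
        refine ⟨by rw [hm0]; nlinarith, hab.2.imp (fun h => ?_) fun h => ?_⟩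
        · rw [hm0, h]; ring
        · rw [hm1, h]; ring
      have e1 : ecost a m = σ := by rw [hm, ecost_of_mem hr0, hr]
      have e2 : ecost m b = ecost a b - σ := by rw [hm, ecost_to_end hr1, ← hr]; ring
      have s1 := segment_subset_of_mem (left_mem_segment ℝ a b) hmem
      have s2 := segment_subset_of_mem hmem (right_mem_segment ℝ a b)
      refine ⟨m, segment ℝ a m ∪ {m}, segment ℝ m b ∪ X, ?_, ?_, ?_⟩
      · simpa [e1] using cons ham (s1.trans hA) (nil m)
      · have := cons hmb (s2.trans hA) h
        rw [e2] at this
        convert this using 1; ring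
      · rintro z (hz | hz)
        · rw [segment_eq_image'] at hz
          obtain ⟨q, ⟨hq0, hq1⟩, rfl⟩ := hz
          rcases le_or_gt q r with hqr | hqr
          · left; left
            rw [segment_eq_image']
            rcases eq_or_lt_of_le hr0 with h0 | h0
            · have : q = 0 := by linarith
              exact ⟨0, by simp, by simp [this]⟩
            · refine ⟨q / r, ⟨by positivity, (div_le_one h0).2 hqr⟩, ?_⟩
              have : q / r * r = q := by field_simp
              simp only [hm, add_sub_cancel_left, smul_smul, this]
          · right; left
            rw [segment_symm, segment_eq_image']
            have h1r : 0 < 1 - r := by linarith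
            refine ⟨(1 - q) / (1 - r), ⟨div_nonneg (by linarith) h1r.le,
              (div_le_one h1r).2 (by linarith)⟩, ?_⟩
            have : m - b = (1 - r) • (a - b) := by rw [hm]; module
            have h' : (1 - q) / (1 - r) * (1 - r) = 1 - q := by field_simp
            simp only [this, smul_smul, h']
            module
        · right; right; exact hz
    · obtain ⟨m, X₁, X₂, h1, h2, h3⟩ := ih (σ := σ - ecost a b) (by linarith) (by linarith)
      refine ⟨m, segment ℝ a b ∪ X₁, X₂, ?_, ?_, ?_⟩
      · convert cons hab hA h1 using 1; ring
      · convert h2 using 1; ring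
      · rw [Set.union_assoc]; exact Set.union_subset_union_right _ h3

/-- Following the path itself costs at most `c` more than the height gained. -/
lemma reach {a b t : Plane} {c : ℝ} {X : Set Plane} (h : Stair A a b c X) (ht : t ∈ X) :
    Reach A a t (t 1 - a 1 + c) := by
  induction h with
  | nil a =>
    obtain rfl : t = a := ht
    simpa using Reach.refl A t
  | @cons a b d c X hab hA h ih =>
    rcases ht with ht | ht
    · refine (Reach.single ((segment_subset_of_mem (left_mem_segment ℝ a b) ht).trans hA)).mono
        subset_rfl ?_
      obtain ⟨r, hr0, hr1, rfl⟩ := apply_mem_segment ht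
      have h1 := ecost_of_mem (a := a) (b := b) hr0
      have h2 := ecost_nonneg a b
      have h3 := h.cost_nonneg
      have h4 : r * ecost a b ≤ ecost a b := mul_le_of_le_one_left h2 hr1
      unfold ecost at h1 h2 h4 ⊢
      linarith
    · refine (Reach.cons hA (ih ht)).mono subset_rfl ?_
      unfold ecost; linarith

lemma sqrt_one_add_sq_le {S : ℝ} (hS : 0 < S) : √(1 + S ^ 2) ≤ S + 1 / (2 * S) := by
  apply Real.sqrt_le_iff.2 ⟨by positivity, ?_⟩
  have : (S + 1 / (2 * S)) ^ 2 = S ^ 2 + 1 + (1 / (2 * S)) ^ 2 := by field_simp; ring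
  rw [this]; nlinarith [sq_nonneg (1 / (2 * S))]

lemma norm_slope {x y x' S : ℝ} (hx : x ≤ x') :
    ‖pt x' y - pt x (y - S * (x' - x))‖ = √(1 + S ^ 2) * (x' - x) := by
  rw [norm_plane]
  have : (pt x' y - pt x (y - S * (x' - x))) 0 ^ 2 + (pt x' y - pt x (y - S * (x' - x))) 1 ^ 2
      = (1 + S ^ 2) * (x' - x) ^ 2 := by simp; ring
  rw [this, Real.sqrt_mul (by positivity), Real.sqrt_sq (by linarith)]

/-- A point below the end of a staircase path is reached from a point below its start by climbing
alternately along vertical edges of the path and along extra segments of slope `S`. -/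
lemma climb {a b : Plane} {c z S : ℝ} {X : Set Plane} (h : Stair A a b c X) (hS : 0 < S)
    (hz : z ≤ b 1) : ∃ z₀ ≤ a 1, a 1 - (S + 1) * c - (b 1 - z) ≤ z₀ ∧
      ∃ Ex, gweight Ex ≤ (S + 1) * c ∧
        Reach (A ∪ segUnion Ex) (pt (a 0) z₀) (pt (b 0) z) (z - z₀ + c / (2 * S)) := by
  induction h with
  | nil a =>
    exact ⟨z, hz, by linarith, ∅, by simp [gweight], by simpa using Reach.refl _ _⟩
  | @cons a b d c X hab hA h ih =>
    obtain ⟨z₁, hz₁, hlow, Ex, hw, hr⟩ := ih hz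
    have he := ecost_nonneg a b
    have hle := hab.fst_add_snd_sub_le hS.le
    rcases hab.2 with h0 | h1
    · refine ⟨min (a 1) z₁, min_le_left _ _, ?_, Ex, ?_, ?_⟩
      · rw [h0] at hle
        have := mul_nonneg hS.le he
        refine le_min ?_ ?_
        · have hc := h.cost_nonneg
          have := mul_nonneg hS.le hc
          linarith
        · linarith
      · have := mul_nonneg (by linarith : 0 ≤ S + 1) he
        linarith
      · rcases le_total (a 1) z₁ with hle | hle
        · rw [min_eq_left hle]
          have hs : segment ℝ (pt (b 0) (a 1)) (pt (b 0) (b 1)) ⊆ A ∪ segUnion Ex := by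
            rw [pt_eta b, ← h0, pt_eta a]
            exact hA.trans Set.subset_union_left
          have := (Reach.vertical hs le_rfl hle hz₁).trans hr
          rw [h0]
          refine this.mono subset_rfl ?_
          have : 0 ≤ ecost a b / (2 * S) := by positivity
          rw [add_div]; linarith
        · rw [min_eq_right hle, h0]
          refine hr.mono subset_rfl ?_
          have : 0 ≤ ecost a b / (2 * S) := by positivity
          rw [add_div]; linarith
    · have hx := hab.1
      have hxe : ecost a b = b 0 - a 0 := by
        rw [ecost, norm_sub_of_snd_eq h1, abs_of_nonneg (by linarith), h1]; ring
      have hsl := norm_slope (x := a 0) (x' := b 0) (y := z₁) (S := S) hx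
      have hsq := sqrt_one_add_sq_le hS
      have hsq' : √(1 + S ^ 2) ≤ S + 1 :=
        Real.sqrt_le_iff.2 ⟨by positivity, by nlinarith⟩
      have hSx := mul_nonneg hS.le (sub_nonneg.2 hx)
      refine ⟨z₁ - S * (b 0 - a 0), by linarith, by linarith,
        {(pt (a 0) (z₁ - S * (b 0 - a 0)), pt (b 0) z₁)} ∪ Ex, ?_, ?_⟩
      · refine (gweight_union_le _ _).trans ?_
        rw [gweight_singleton, hsl, hxe]
        have := mul_le_mul_of_nonneg_right hsq' (sub_nonneg.2 hx)
        linarith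
      · rw [segUnion_union]
        refine (Reach.cons ?_ (hr.mono ?_ le_rfl)).mono subset_rfl ?_
        · exact (segment_subset_segUnion (Finset.mem_singleton_self _)).trans
            (Set.subset_union_left.trans Set.subset_union_right)
        · intro z; simp only [Set.mem_union]; tauto
        · rw [hsl, hxe]
          have := mul_le_mul_of_nonneg_right hsq (sub_nonneg.2 hx)
          rw [add_div]
          have e : (S + 1 / (2 * S)) * (b 0 - a 0) = S * (b 0 - a 0) + (b 0 - a 0) / (2 * S) := by
            ring
          linarith

/-- A shallow-light tree of depth `k` from the point at distance `h` below the start of a staircase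
path to all points of the path. -/
lemma exists_tree (k : ℕ) {a b : Plane} {c h w : ℝ} {X : Set Plane} (hP : Stair A a b c X)
    (hc : c ≤ w) (hh : 0 < h) (hw : 0 < w) (hk : k = 0 ∨ 2 * w * (3 / 2) ^ k ≤ h) :
    ∃ Ex, gweight Ex ≤ 9 / 2 * h + w * k / 2 ∧
      ∀ t ∈ X, Reach (A ∪ segUnion Ex) (pt (a 0) (a 1 - h)) t
        (t 1 - a 1 + h + (w ^ 2 / h + w / 2 ^ k)) := by
  induction k generalizing a b c h w X with
  | zero =>
    refine ⟨{(pt (a 0) (a 1 - h), pt (a 0) (a 1))}, ?_, fun t ht => ?_⟩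
    · rw [gweight_singleton, norm_sub_of_fst_eq (by simp)]
      simp [abs_of_pos hh]; linarith
    · have h1 : Reach (A ∪ segUnion {(pt (a 0) (a 1 - h), pt (a 0) (a 1))})
          (pt (a 0) (a 1 - h)) (pt (a 0) (a 1)) (a 1 - (a 1 - h)) :=
        Reach.vertical ((segment_subset_segUnion (by simp)).trans Set.subset_union_right)
          le_rfl (by linarith) le_rfl
      rw [pt_eta a] at h1
      refine (h1.trans ((hP.reach ht).mono Set.subset_union_left le_rfl)).mono
        (by rw [pt_eta]) ?_
      have : 0 ≤ w ^ 2 / h := by positivity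
      simp only [pow_zero, div_one]
      linarith
  | succ k ih =>
    have hk : 2 * w * (3 / 2) ^ (k + 1) ≤ h := hk.resolve_left (by omega)
    have hwh : 3 * w ≤ h := by
      refine le_trans ?_ hk
      have : (1 : ℝ) ≤ (3 / 2) ^ k := one_le_pow₀ (by norm_num)
      rw [pow_succ]; nlinarith
    have hc0 := hP.cost_nonneg
    obtain ⟨m, X₁, X₂, h1, h2, hX⟩ := hP.split (σ := c / 2) (by linarith) (by linarith)
    have hk' : 2 * (w / 2) * (3 / 2) ^ k ≤ h / 3 := by
      rw [pow_succ] at hk; linarith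
    obtain ⟨E₁, hE₁, hr₁⟩ := ih h1 (h := h / 3) (w := w / 2) (by linarith) (by linarith)
      (by linarith) (Or.inr hk')
    obtain ⟨E₂, hE₂, hr₂⟩ := ih h2 (h := h / 3) (w := w / 2) (by linarith) (by linarith)
      (by linarith) (Or.inr hk')
    have hS : 0 < h / w := by positivity
    obtain ⟨z₀, hz₀, hlow, E₃, hE₃, hr₃⟩ := h1.climb (z := m 1 - h / 3) hS (by linarith)
    have hSw : (h / w + 1) * (c / 2) ≤ h / 2 + w / 2 := by
      have : (h / w + 1) * (w / 2) = h / 2 + w / 2 := by field_simp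
      rw [← this]
      exact mul_le_mul_of_nonneg_left (by linarith) (by positivity)
    set T : Finset (Plane × Plane) := {(pt (a 0) (a 1 - h), pt (a 0) (a 1))} with hT
    have hTr : segment ℝ (pt (a 0) (a 1 - h)) (pt (a 0) (a 1)) ⊆ segUnion T :=
      segment_subset_segUnion (by simp [hT])
    have hTw : gweight T = h := by
      rw [hT, gweight_singleton, norm_sub_of_fst_eq (by simp)]
      simp [abs_of_pos hh]
    have hover : (w / 2) ^ 2 / (h / 3) + (w / 2) / 2 ^ k + w ^ 2 / (4 * h)
        = w ^ 2 / h + w / 2 ^ (k + 1) := by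
      rw [pow_succ]; field_simp; ring
    have hpos : 0 ≤ w ^ 2 / (4 * h) := by positivity
    refine ⟨T ∪ E₁ ∪ E₂ ∪ E₃, ?_, fun t ht => ?_⟩
    · have g1 := gweight_union_le (T ∪ E₁ ∪ E₂) E₃
      have g2 := gweight_union_le (T ∪ E₁) E₂
      have g3 := gweight_union_le T E₁
      push_cast
      linarith
    · simp only [segUnion_union]
      rcases hX ht with ht | ht
      · have t1 : Reach (segUnion T) (pt (a 0) (a 1 - h)) (pt (a 0) (a 1 - h / 3)) _ :=
          Reach.vertical hTr le_rfl (by linarith) (by linarith)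
        refine ((t1.mono ?_ le_rfl).trans ((hr₁ t ht).mono ?_ le_rfl)).mono subset_rfl ?_
        · intro z; simp only [Set.mem_union]; tauto
        · intro z; simp only [Set.mem_union]; tauto
        · linarith
      · have t1 : Reach (segUnion T) (pt (a 0) (a 1 - h)) (pt (a 0) z₀) _ :=
          Reach.vertical hTr le_rfl (by linarith) (by linarith)
        refine (((t1.mono ?_ le_rfl).trans (hr₃.mono ?_ le_rfl)).trans
          ((hr₂ t ht).mono ?_ le_rfl)).mono subset_rfl ?_
        · intro z; simp only [Set.mem_union]; tauto
        · intro z; simp only [Set.mem_union]; tauto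
        · intro z; simp only [Set.mem_union]; tauto
        · have : c / 2 / (2 * (h / w)) ≤ w ^ 2 / (4 * h) := by
            have e : w ^ 2 / (4 * h) = w / 2 / (2 * (h / w)) := by field_simp; ring
            rw [e]
            gcongr
          linarith

end Stair

lemma exists_stair_of_vertices {A : Set Plane} (n : ℕ) (u : ℕ → Plane)
    (hu : ∀ i < n, StairEdge (u i) (u (i + 1)))
    (hA : ∀ i < n, segment ℝ (u i) (u (i + 1)) ⊆ A) :
    ∃ X, Stair A (u 0) (u n) (∑ i ∈ Finset.range n, ecost (u i) (u (i + 1))) X ∧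
      ∀ i < n, segment ℝ (u i) (u (i + 1)) ⊆ X := by
  induction n generalizing u with
  | zero => exact ⟨_, by simpa using Stair.nil (u 0), by simp⟩
  | succ n ih =>
    obtain ⟨X, hX, hsub⟩ := ih (fun i => u (i + 1)) (fun i hi => hu (i + 1) (by omega))
      (fun i hi => hA (i + 1) (by omega))
    refine ⟨segment ℝ (u 0) (u 1) ∪ X, ?_, ?_⟩
    · rw [Finset.sum_range_succ', add_comm (∑ _ ∈ _, _)]
      exact Stair.cons (hu 0 (by omega)) (hA 0 (by omega)) hX
    · rintro (_ | i) hi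
      · exact Set.subset_union_left
      · exact (hsub i (by omega)).trans Set.subset_union_right

lemma segment_apply_ge {a b t : Plane} {y : ℝ} (ht : t ∈ segment ℝ a b) (ha : y ≤ a 1)
    (hb : y ≤ b 1) : y ≤ t 1 := by
  obtain ⟨r, h0, h1, rfl⟩ := apply_mem_segment ht
  simp; nlinarith

lemma exists_mem_segment_fst_eq {a b : Plane} {x : ℝ} (ha : a 0 ≤ x) (hb : x ≤ b 0) :
    ∃ t ∈ segment ℝ a b, t 0 = x := by
  rcases eq_or_lt_of_le (ha.trans hb) with h | h
  · exact ⟨a, left_mem_segment _ _ _, by linarith⟩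
  · refine ⟨a + ((x - a 0) / (b 0 - a 0)) • (b - a), ?_, ?_⟩
    · rw [segment_eq_image']
      exact ⟨_, ⟨div_nonneg (by linarith) (by linarith),
        (div_le_one (by linarith)).2 (by linarith)⟩, rfl⟩
    · have : b 0 - a 0 ≠ 0 := by linarith
      simp
      field_simp
      ring

/-- On a tame path all of whose vertices are at least as high as its start, the length exceeds the
signed height by at most twice the width. -/
lemma IsTamePath.cost_le {n : ℕ} {u : ℕ → Plane} (hT : IsTamePath n u)
    (hlow : ∀ i ≤ n, u 0 1 ≤ u i 1) (j : ℕ) (hj : j ≤ n) :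
    ∑ i ∈ Finset.range j, ecost (u i) (u (i + 1)) ≤ 2 * (u j 0 - u 0 0) := by
  obtain ⟨hrect, hmono, hchord⟩ := hT
  induction j using Nat.strong_induction_on with
  | _ j ih =>
  rcases j with _ | j
  · simp
  have hjx := hmono j (by omega)
  by_cases hdesc : u j 1 ≤ u (j + 1) 1
  · rw [Finset.sum_range_succ]
    have h1 := ih j (by omega) (by omega)
    have : ecost (u j) (u (j + 1)) ≤ 2 * (u (j + 1) 0 - u j 0) := by
      rcases hrect j (by omega) with h | h
      · rw [ecost, norm_sub_of_fst_eq h, abs_of_nonneg (by linarith)]; linarith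
      · rw [ecost, norm_sub_of_snd_eq h, abs_of_nonneg (by linarith)]; linarith
    linarith
  push Not at hdesc
  set y := u (j + 1) 1 with hy
  obtain ⟨i, hij, hiy, hup⟩ : ∃ i < j, u i 1 ≤ y ∧ ∀ k, i < k → k ≤ j → y < u k 1 := by
    have hex : ∃ i ≤ j, u i 1 ≤ y := ⟨0, by omega, hlow _ hj⟩
    obtain ⟨i₀, hi₀, hi₀y⟩ := hex
    set i := Nat.findGreatest (fun i => u i 1 ≤ y) j
    have hi : u i 1 ≤ y := Nat.findGreatest_spec (P := fun i => u i 1 ≤ y) hi₀ hi₀y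
    have hle : i ≤ j := Nat.findGreatest_le j
    have hne : i ≠ j := by
      intro h; rw [h] at hi; linarith
    refine ⟨i, by omega, hi, fun k hk hkj => ?_⟩
    by_contra! hcon
    exact Nat.findGreatest_is_greatest (P := fun i => u i 1 ≤ y) hk hkj hcon
  have hxi : u i 0 = u (i + 1) 0 := by
    rcases hrect i (by omega) with h | h
    · exact h
    · have := hup (i + 1) (by omega) (by omega); linarith
  have hmonox : ∀ k, i ≤ k → ∀ l, k ≤ l → l ≤ n → u k 0 ≤ u l 0 := by
    intro k _ l hkl
    induction l, hkl using Nat.le_induction with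
    | base => intro _; rfl
    | succ l _ ihl => intro hl; exact (ihl (by omega)).trans (hmono l (by omega))
  set a := pt (u i 0) y with ha
  have hupi := hup (i + 1) (by omega) (by omega)
  have haseg : a ∈ segment ℝ (u i) (u (i + 1)) := by
    have := mem_segment_vertical (x := u i 0) hiy hupi.le
    rwa [pt_eta, hxi, pt_eta, ← hxi] at this
  have hsub : segment ℝ a (u (j + 1)) ⊆ belowRegion (pathSet n u) := by
    intro p hp
    obtain ⟨r, hr0, hr1, hpr⟩ := apply_mem_segment hp
    have hp1 : p 1 = y := by rw [hpr]; simp [ha, ← hy]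
    have hxij := hmonox i le_rfl (j + 1) (by omega) hj
    have hp0 : p 0 = u i 0 + r * (u (j + 1) 0 - u i 0) := by rw [hpr]; simp [ha]
    have hpl : u (i + 1) 0 ≤ p 0 := by rw [hp0, ← hxi]; nlinarith
    have hpr' : p 0 ≤ u (j + 1) 0 := by rw [hp0]; nlinarith
    have hmem : ∀ k < n, ∀ q ∈ segment ℝ (u k) (u (k + 1)), q ∈ pathSet n u := fun k hk q hq =>
      Set.mem_iUnion₂.2 ⟨k, Finset.mem_range.2 hk, hq⟩
    refine ⟨?_, u (j + 1), hmem j (by omega) _ (right_mem_segment _ _ _), by rw [hp1]⟩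
    have hfind : ∀ l, i + 1 ≤ l → l ≤ j + 1 → p 0 ≤ u l 0 → l ≠ i + 1 →
        ∃ k, i + 1 ≤ k ∧ k ≤ j ∧ u k 0 ≤ p 0 ∧ p 0 ≤ u (k + 1) 0 := by
      intro l hl
      induction l, hl using Nat.le_induction with
      | base => intro _ _ h; exact absurd rfl h
      | succ l hil ihl =>
        intro hlj hpl' _
        rcases le_or_gt (u l 0) (p 0) with h | h
        · exact ⟨l, hil, by omega, h, hpl'⟩
        · refine ihl (by omega) h.le ?_
          rintro rfl
          linarith
    obtain ⟨k, hik, hkj, hk1, hk2⟩ := hfind (j + 1) (by omega) le_rfl hpr' (by omega)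
    obtain ⟨q, hq, hq0⟩ := exists_mem_segment_fst_eq hk1 hk2
    refine ⟨q, hmem k (by omega) q hq, hq0, ?_⟩
    rw [hp1]
    refine segment_apply_ge hq (hup k (by omega) hkj).le ?_
    rcases eq_or_lt_of_le hkj with rfl | h
    · exact le_rfl
    · exact (hup (k + 1) (by omega) (by omega)).le
  have hlen := hchord i j a (u (j + 1)) hij.le (by omega) haseg (right_mem_segment _ _ _)
    (by simp [ha, ← hy]) hsub
  have hstart : ‖u (i + 1) - a‖ = u (i + 1) 1 - y := by
    rw [norm_sub_of_fst_eq (by simp [ha, hxi]), abs_of_nonneg (by simp [ha, hupi.le])]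
    rfl
  have hwidth : ‖u (j + 1) - a‖ = u (j + 1) 0 - u i 0 := by
    rw [norm_sub_of_snd_eq (by simp [ha, ← hy]),
      abs_of_nonneg (by simpa [ha] using hmonox i le_rfl (j + 1) (by omega) hj)]
    rfl
  rw [subLen, if_neg (by omega), norm_sub_rev a, hstart, hwidth] at hlen
  have hih := ih i (by omega) (by omega)
  have htel : ∑ k ∈ Finset.Ico (i + 1) j, ecost (u k) (u (k + 1))
      = ∑ k ∈ Finset.Ico (i + 1) j, ‖u (k + 1) - u k‖ - (u j 1 - u (i + 1) 1) := by
    rw [← Finset.sum_Ico_sub (fun k => u k 1) (by omega : i + 1 ≤ j), ← Finset.sum_sub_distrib]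
    rfl
  have hei : ecost (u i) (u (i + 1)) = 0 := by
    rw [ecost, norm_sub_of_fst_eq hxi, abs_of_nonneg (by linarith)]; ring
  rw [Finset.sum_range_succ, ← Finset.sum_range_add_sum_Ico _ (by omega : i + 1 ≤ j),
    Finset.sum_range_succ, hei, htel]
  have : ecost (u j) (u (j + 1)) = ‖u (j + 1) - u j‖ - (y - u j 1) := rfl
  linarith

/-- The reflection of the plane in a horizontal line. -/
def reflectIsometry (e : ℝ) : Plane →ᵃⁱ[ℝ] Plane where
  toFun p := pt (p 0) (e - p 1)
  linear :=
    { toFun := fun p => pt (p 0) (-p 1)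
      map_add' := fun p q => by ext i; fin_cases i <;> simp [pt]; ring
      map_smul' := fun r p => by ext i; fin_cases i <;> simp [pt] }
  map_vadd' p v := by ext i; fin_cases i <;> simp [pt]; ring
  norm_map v := by simp [norm_plane]

@[simp] lemma reflectIsometry_apply (e : ℝ) (p : Plane) :
    reflectIsometry e p = pt (p 0) (e - p 1) := rfl

lemma exists_gweight_image_le (E : Finset (Plane × Plane)) (φ : Plane →ᵃⁱ[ℝ] Plane) :
    ∃ F, gweight F ≤ gweight E ∧ φ '' segUnion E ⊆ segUnion F := by
  refine ⟨E.image fun e => (φ e.1, φ e.2), ?_, ?_⟩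
  · unfold gweight
    refine (Finset.sum_image_le_of_nonneg fun _ _ => norm_nonneg _).trans (le_of_eq ?_)
    refine Finset.sum_congr rfl fun e _ => ?_
    rw [← dist_eq_norm, ← dist_eq_norm, φ.dist_map]
  · rintro _ ⟨z, hz, rfl⟩
    obtain ⟨e, he, hz⟩ := Set.mem_iUnion₂.1 hz
    have hmem : φ z ∈ segment ℝ (φ e.1) (φ e.2) := by
      have h : φ '' segment ℝ e.1 e.2 = segment ℝ (φ e.1) (φ e.2) :=
        image_segment ℝ φ.toAffineMap e.1 e.2
      rw [← h]
      exact Set.mem_image_of_mem _ hz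
    exact segment_subset_segUnion (Finset.mem_image.2 ⟨e, he, rfl⟩) hmem

/-- The depth of the shallow-light trees. -/
lemma exists_depth {N : ℝ} (hN : 1 ≤ N) :
    ∃ k : ℕ, (k = 0 ∨ 2 * 2 * (3 / 2 : ℝ) ^ k ≤ N) ∧ (k : ℝ) ≤ N ∧ 2 / 2 ^ k ≤ 16 / N := by
  obtain ⟨m, hm1, hm2⟩ := exists_nat_pow_near hN (by norm_num : (1 : ℝ) < 2)
  have hmlt : (m : ℝ) < 2 ^ m := by exact_mod_cast Nat.lt_two_pow_self
  have hNpos : 0 < N := by linarith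
  rcases le_or_gt m 2 with h | h
  · refine ⟨0, Or.inl rfl, by simpa using hNpos.le, ?_⟩
    have : N ≤ 8 := hm2.le.trans (by
      have : (2 : ℝ) ^ (m + 1) ≤ 2 ^ 3 := pow_le_pow_right₀ (by norm_num) (by omega)
      linarith)
    rw [pow_zero, div_one, le_div_iff₀ hNpos]; linarith
  · obtain ⟨k, rfl⟩ : ∃ k, m = k + 2 := ⟨m - 2, by omega⟩
    refine ⟨k, Or.inr ?_, ?_, ?_⟩
    · have : (3 / 2 : ℝ) ^ k ≤ 2 ^ k := by gcongr; norm_num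
      rw [pow_add] at hm1
      linarith
    · push_cast at hmlt; linarith
    · rw [div_le_div_iff₀ (by positivity) hNpos]
      rw [pow_add, pow_add] at hm2
      linarith

/-- A shallow-light tree from a root at distance `N` above the left end of a horizontal segment of
unit length to all points of the segment. -/
lemma exists_base_tree {N : ℝ} (hN : 0 < N) {k : ℕ}
    (hk : k = 0 ∨ 2 * 2 * (3 / 2 : ℝ) ^ k ≤ N) :
    ∃ F, gweight F ≤ 1 + (9 / 2 * N + k) ∧
      ∀ s ∈ segment ℝ (pt 0 (-(2 * N))) (pt 1 (-(2 * N))),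
        Reach (segUnion F) s (pt 0 (-N)) (N + (4 / N + 2 / 2 ^ k)) := by
  set B : Finset (Plane × Plane) := {(pt 0 0, pt 1 0)} with hB
  have hBw : gweight B = 1 := by
    rw [hB, gweight_singleton, norm_sub_of_snd_eq (by simp)]; simp
  have hcost : ecost (pt 0 0) (pt 1 0) = 1 := by
    rw [ecost, norm_sub_of_snd_eq (by simp)]; simp
  have hst : Stair (segUnion B) (pt 0 0) (pt 1 0) _ _ :=
    Stair.cons ⟨by simp, Or.inr (by simp)⟩ (segment_subset_segUnion (by simp [hB])) (Stair.nil _)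
  obtain ⟨E, hEw, hE⟩ := hst.exists_tree k (h := N) (w := 2) (by rw [hcost]; norm_num) hN
    (by norm_num) hk
  set φ := reflectIsometry (-(2 * N)) with hφ
  obtain ⟨F, hFw, hF⟩ := exists_gweight_image_le (B ∪ E) φ
  refine ⟨F, ?_, fun s hs => ?_⟩
  · have := gweight_union_le B E
    linarith
  · obtain ⟨r, hr0, hr1, rfl⟩ := apply_mem_segment hs
    have ht : pt r 0 ∈ segment ℝ (pt 0 0) (pt 1 0) := by
      rw [segment_eq_image']
      refine ⟨r, ⟨hr0, hr1⟩, ?_⟩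
      ext i; fin_cases i <;> simp [pt]
    have := (hE _ (Or.inl ht)).image φ
    rw [← segUnion_union] at this
    have e1 : φ (pt (pt 0 0 0) (pt 0 0 1 - N)) = pt 0 (-N) := by
      simp only [hφ, reflectIsometry_apply, pt_zero, pt_one]; congr 1; ring
    have e2 : φ (pt r 0)
        = pt 0 (-(2 * N)) + r • (pt 1 (-(2 * N)) - pt 0 (-(2 * N))) := by
      ext i; fin_cases i <;> simp [hφ, pt]
    rw [e1, e2] at this
    refine this.symm.mono hF ?_
    simp only [pt_one]
    norm_num

end Helpers

-- **Statement 17.** There is an absolute constant `C > 0` such that for every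
-- `ε ∈ (0,1]` the following holds. Let `R = [0,1] × [−2ε^{-1/2}, 0]`, let `p = (0,0)`
-- be its upper-left corner, let `q = (1, y_q)` with `y_q ≥ 0`, and let `L` be a tame
-- path from `p` to `q` lying on or above the line through `p` and `q`. Then there is a
-- geometric graph comprised of the edges of `L` and additional segments of total weight
-- at most `C·ε^{-1/2}` containing, for every `s` on the bottom side of `R` and every
-- `t ∈ L`, an `st`-path of weight at most `(1 + C·ε)·‖s − t‖`.
theorem tame_path_to_base_spanner :
    ∃ C : ℝ, 0 < C ∧
      ∀ ε : ℝ, 0 < ε → ε ≤ 1 →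
      ∀ y_q : ℝ, 0 ≤ y_q →
      ∀ (n : ℕ) (u : ℕ → Plane), IsTamePath n u →
        u 0 = pt 0 0 → u n = pt 1 y_q →
        (∀ z ∈ pathSet n u, y_q * z 0 ≤ z 1) →
        ∃ Ex : Finset (Plane × Plane),
          gweight Ex ≤ C * (Real.sqrt ε)⁻¹ ∧
          ∀ s ∈ segment ℝ (pt 0 (-(2 * (Real.sqrt ε)⁻¹))) (pt 1 (-(2 * (Real.sqrt ε)⁻¹))),
          ∀ t ∈ pathSet n u,
            HasPath (pathEdges n u ∪ Ex) s t ((1 + C * ε) * ‖s - t‖) := by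
  refine ⟨20, by norm_num, ?_⟩
  intro ε hε hε1 y_q hyq n u hT hu0 hun habove
  have hsε : 0 < √ε := Real.sqrt_pos.2 hε
  set N := (√ε)⁻¹ with hNdef
  have hN : 1 ≤ N := (one_le_inv₀ hsε).2 (Real.sqrt_le_one.2 hε1)
  have hNpos : 0 < N := by linarith
  have hεN : ε * N ^ 2 = 1 := by
    rw [hNdef, inv_pow, Real.sq_sqrt hε.le, mul_inv_cancel₀ hε.ne']
  obtain ⟨k, hk, hkN, hk2⟩ := exists_depth hN
  obtain ⟨F, hFw, hF⟩ := exists_base_tree hNpos hk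
  have hedge : ∀ i < n, segment ℝ (u i) (u (i + 1)) ⊆ segUnion (pathEdges n u) := fun i hi =>
    segment_subset_segUnion (Finset.mem_image.2 ⟨i, Finset.mem_range.2 hi, rfl⟩)
  have hmono0 : ∀ i ≤ n, u 0 0 ≤ u i 0 := by
    intro i
    induction i with
    | zero => intro _; rfl
    | succ i ih => intro hi; exact (ih (by omega)).trans (hT.2.1 i (by omega))
  have hlow : ∀ i ≤ n, u 0 1 ≤ u i 1 := by
    intro i hi
    rcases Nat.eq_zero_or_pos i with rfl | hpos
    · rfl
    · have hmem : u i ∈ pathSet n u := by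
        refine Set.mem_iUnion₂.2 ⟨i - 1, Finset.mem_range.2 (by omega), ?_⟩
        rw [Nat.sub_add_cancel hpos]
        exact right_mem_segment _ _ _
      have h1 := habove _ hmem
      have h2 := hmono0 i hi
      rw [hu0] at h2 ⊢
      exact (mul_nonneg hyq h2).trans h1
  have hcost := hT.cost_le hlow n le_rfl
  obtain ⟨X, hX, hsub⟩ := exists_stair_of_vertices n u
    (fun i hi => ⟨hT.2.1 i hi, hT.1 i hi⟩) hedge
  obtain ⟨E, hEw, hE⟩ := hX.exists_tree k (h := N) (w := 2)
    (by rw [hu0, hun] at hcost; simpa using hcost) hNpos (by norm_num) hk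
  refine ⟨E ∪ F, ?_, fun s hs t ht => ?_⟩
  · have := gweight_union_le E F
    linarith
  obtain ⟨i, hi, hti⟩ := Set.mem_iUnion₂.1 ht
  have hi := Finset.mem_range.1 hi
  have ht1 : 0 ≤ t 1 := by
    refine segment_apply_ge hti ?_ ?_
    · simpa [hu0] using hlow i hi.le
    · simpa [hu0] using hlow (i + 1) hi
  have hr := hE t (hsub i hi hti)
  rw [hu0] at hr
  simp only [pt_zero, pt_one, zero_sub] at hr
  have hs1 : s 1 = -(2 * N) := by
    obtain ⟨r, _, _, rfl⟩ := apply_mem_segment hs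
    simp
  have hpath := ((hF s hs).mono (B' := segUnion (pathEdges n u ∪ (E ∪ F)))
    (by intro z; simp only [segUnion_union, Set.mem_union]; tauto) le_rfl).trans
    (hr.mono (by intro z; simp only [segUnion_union, Set.mem_union]; tauto) le_rfl)
  refine hpath.mono subset_rfl ?_
  have hd : t 1 + 2 * N ≤ ‖s - t‖ := by
    have := snd_sub_le_norm s t
    rw [norm_sub_rev, hs1] at this
    linarith
  have hinv : 1 / N = ε * N := by
    rw [div_eq_iff hNpos.ne', ← hεN]; ring
  have hover : 20 * (2 * (1 / N)) ≤ 20 * ε * ‖s - t‖ := by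
    rw [hinv]
    have : ε * (2 * N) ≤ ε * ‖s - t‖ := mul_le_mul_of_nonneg_left (by linarith) hε.le
    linarith
  have e1 : (4 : ℝ) / N = 4 * (1 / N) := by ring
  have e2 : (16 : ℝ) / N = 16 * (1 / N) := by ring
  rw [e2] at hk2
  norm_num at hpath ⊢
  linarith

end
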